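/- arXiv:2009.14140 — 2 statements merged into one kernel-verified Lean document; each statement's English description precedes it below -/
import Mathlib

section
/- There exists a constant c > 0 such that for every ε ∈ (0,1], every integer p ≥ 1, and every real polynomial q in one variable of degree at most p, there exists a twice continuously differentiable function v : ℝ² → ℝ satisfying: (i) v(x,0) = q(x) for all x ∈ [0,1]; (ii) ∫_S v² ≤ c · ε · ∫_0^1 q(x)² dx; (iii) ∫_S ((∂_x v)² + (∂_y v)²) ≤ c · (ε·p⁴ + ε^{−1}) · ∫_0^1 q(x)² dx; (iv) ∫_S ((∂_{xx} v)² + 2(∂_{xy} v)² + (∂_{yy} v)²) ≤ c · (ε·p⁸ + ε^{−3} + ε^{−1}·p⁴) · ∫_0^1 q(x)² dx; where S = [0,1]². -/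
open MeasureTheory

/-- The unit square `S = [0,1]²`. -/
def unitSquare : Set (ℝ × ℝ) := Set.Icc (0 : ℝ) 1 ×ˢ Set.Icc (0 : ℝ) 1

/-- Partial derivative in the `x` direction. -/
noncomputable def dx (v : ℝ × ℝ → ℝ) (z : ℝ × ℝ) : ℝ := fderiv ℝ v z (1, 0)

/-- Partial derivative in the `y` direction. -/
noncomputable def dy (v : ℝ × ℝ → ℝ) (z : ℝ × ℝ) : ℝ := fderiv ℝ v z (0, 1)

open Polynomial in
/-- Integration of polynomials over `[0,1]`. -/
noncomputable def polyInt : ℝ[X] →ₗ[ℝ] ℝ where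
  toFun f := ∫ x in (0:ℝ)..1, f.eval x
  map_add' f g := by
    simp only [Polynomial.eval_add]
    exact intervalIntegral.integral_add (f.continuous.intervalIntegrable _ _)
      (g.continuous.intervalIntegrable _ _)
  map_smul' a f := by
    simp only [Polynomial.eval_smul, smul_eq_mul, RingHom.id_apply]
    exact intervalIntegral.integral_const_mul _ _

namespace ExtStab
open Polynomial

lemma polyInt_apply (f : ℝ[X]) : polyInt f = ∫ x in (0:ℝ)..1, f.eval x := rfl

lemma polyInt_C_mul (a : ℝ) (f : ℝ[X]) : polyInt (C a * f) = a * polyInt f := by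
  rw [← Polynomial.smul_eq_C_mul, map_smul, smul_eq_mul]

lemma polyInt_deriv (f : ℝ[X]) : polyInt (derivative f) = f.eval 1 - f.eval 0 := by
  rw [polyInt_apply]
  exact intervalIntegral.integral_eq_sub_of_hasDerivAt (fun x _ => f.hasDerivAt x)
    ((derivative f).continuous.intervalIntegrable _ _)

lemma polyInt_nonneg (f : ℝ[X]) (h : ∀ x ∈ Set.Icc (0:ℝ) 1, 0 ≤ f.eval x) : 0 ≤ polyInt f :=
  intervalIntegral.integral_nonneg zero_le_one h

lemma polyInt_sq_nonneg (f : ℝ[X]) : 0 ≤ polyInt (f * f) :=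
  polyInt_nonneg _ fun x _ => by rw [eval_mul]; exact mul_self_nonneg _

lemma polyInt_sq_eq_zero (f : ℝ[X]) (h : polyInt (f * f) = 0) : f = 0 := by
  by_contra hf
  have hz : ∀ x ∈ Set.Ioo (0:ℝ) 1, f.eval x = 0 := by
    intro x hx
    by_contra hne
    have : 0 < ∫ x in (0:ℝ)..1, (f * f).eval x := by
      apply intervalIntegral.integral_pos zero_lt_one (f * f).continuous.continuousOn
      · intro y _
        rw [eval_mul]; exact mul_self_nonneg _
      · exact ⟨x, Set.Ioo_subset_Icc_self hx, by rw [eval_mul]; exact mul_self_pos.2 hne⟩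
    rw [polyInt_apply] at h
    linarith
  exact hf (Polynomial.eq_zero_of_infinite_isRoot f
    ((Set.Ioo_infinite (zero_lt_one (α := ℝ))).mono fun x hx => hz x hx))

/-- the weight `x(1-x)` -/
noncomputable def w : ℝ[X] := X - X ^ 2

lemma polyInt_w_sq_nonneg (f : ℝ[X]) : 0 ≤ polyInt (w * (f * f)) :=
  polyInt_nonneg _ fun x hx => by
    simp only [w, eval_mul, eval_sub, eval_X, eval_pow]
    exact mul_nonneg (by nlinarith [hx.1, hx.2]) (mul_self_nonneg _)

/-- Legendre operator -/
noncomputable def Leg (f : ℝ[X]) : ℝ[X] := - derivative (w * derivative f)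

lemma polyInt_Leg (f g : ℝ[X]) :
    polyInt (Leg f * g) = polyInt (w * (derivative f * derivative g)) := by
  have h := polyInt_deriv (w * derivative f * g)
  have h0 : (w * derivative f * g).eval 1 - (w * derivative f * g).eval 0 = 0 := by
    simp [w]
  rw [h0, derivative_mul, map_add] at h
  have e1 : Leg f * g = - (derivative (w * derivative f) * g) := by rw [Leg, neg_mul]
  have e2 : w * derivative f * derivative g = w * (derivative f * derivative g) := by ring
  rw [e1, map_neg]
  rw [e2] at h
  linarith

lemma polyInt_Leg_symm (f g : ℝ[X]) : polyInt (Leg f * g) = polyInt (f * Leg g) := by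
  rw [polyInt_Leg, mul_comm f, polyInt_Leg, mul_comm (derivative f)]

lemma coeff_Leg (f : ℝ[X]) (k : ℕ) :
    (Leg f).coeff k = k * (k + 1) * f.coeff k - (k + 1) ^ 2 * f.coeff (k + 1) := by
  have h1 : (X * derivative f).coeff k = k * f.coeff k := by
    cases k with
    | zero => simp
    | succ k => rw [coeff_X_mul, coeff_derivative]; push_cast; ring
  have h2 : w * derivative f = X * derivative f - X * (X * derivative f) := by
    simp only [w]; ring
  rw [Leg, coeff_neg, coeff_derivative, h2, coeff_sub, coeff_X_mul, coeff_X_mul, h1,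
    coeff_derivative]
  ring

/-- orthogonal projections exist -/
lemma exists_proj (n : ℕ) : ∀ f : ℝ[X], ∃ s : ℝ[X], (∀ k, n ≤ k → s.coeff k = 0) ∧
    ∀ t : ℝ[X], (∀ k, n ≤ k → t.coeff k = 0) → polyInt ((f - s) * t) = 0 := by
  induction n with
  | zero =>
    intro f
    refine ⟨0, by simp, fun t ht => ?_⟩
    have : t = 0 := by ext k; simpa using ht k (Nat.zero_le k)
    simp [this]
  | succ n ih =>
    intro f
    obtain ⟨r, hr, hr'⟩ := ih (X ^ n)
    obtain ⟨s, hs, hs'⟩ := ih f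
    set l := X ^ n - r with hl
    have hln : l.coeff n = 1 := by simp [hl, hr n le_rfl]
    have hlk : ∀ k, n + 1 ≤ k → l.coeff k = 0 := by
      intro k hk
      rw [hl, coeff_sub, coeff_X_pow, hr k (by omega), if_neg (by omega), sub_zero]
    have hl0 : l ≠ 0 := by
      intro h; rw [h] at hln; simp at hln
    have hll : polyInt (l * l) ≠ 0 := fun h => hl0 (polyInt_sq_eq_zero l h)
    set a := polyInt ((f - s) * l) / polyInt (l * l) with ha
    refine ⟨s + C a * l, fun k hk => ?_, fun t ht => ?_⟩
    · rw [coeff_add, coeff_C_mul, hs k (by omega), hlk k hk]; simp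
    · set u := t - C (t.coeff n) * l with hu
      have huk : ∀ k, n ≤ k → u.coeff k = 0 := by
        intro k hk
        rw [hu, coeff_sub, coeff_C_mul]
        rcases Nat.eq_or_lt_of_le hk with h | h
        · rw [← h, hln]; ring
        · rw [ht k h, hlk k h]; ring
      have e : (f - (s + C a * l)) * t
          = (f - s) * u - C a * (l * u) + C (t.coeff n) * ((f - s) * l)
            - C (t.coeff n) * (C a * (l * l)) := by
        rw [hu]; ring
      rw [e]
      simp only [map_add, map_sub, polyInt_C_mul]
      rw [hs' u huk, hr' u huk, ha]
      field_simp
      ring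

/-- Bernstein-type inequality -/
lemma bernstein (n : ℕ) : ∀ q : ℝ[X], (∀ k, n ≤ k → q.coeff k = 0) →
    polyInt (w * (derivative q * derivative q)) ≤ n * (n + 1) * polyInt (q * q) := by
  induction n with
  | zero =>
    intro q hq
    have : q = 0 := by ext k; simpa using hq k (Nat.zero_le k)
    simp [this]
  | succ n ih =>
    intro q hq
    obtain ⟨s, hs, hs'⟩ := exists_proj n q
    set l := q - s with hl
    have hlk : ∀ k, n + 1 ≤ k → l.coeff k = 0 := by
      intro k hk
      rw [hl, coeff_sub, hs k (by omega), hq k hk, sub_zero]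
    set e := Leg l - C ((n:ℝ) * (n + 1)) * l with he
    have hek : ∀ k, n ≤ k → e.coeff k = 0 := by
      intro k hk
      rw [he, coeff_sub, coeff_C_mul, coeff_Leg, hlk (k+1) (by omega)]
      rcases Nat.eq_or_lt_of_le hk with h | h
      · rw [← h]; ring
      · rw [hlk k h]; ring
    have hLek : ∀ k, n ≤ k → (Leg e).coeff k = 0 := by
      intro k hk
      rw [coeff_Leg, hek k hk, hek (k+1) (by omega)]; ring
    have he0 : e = 0 := by
      apply polyInt_sq_eq_zero
      have : e * e = Leg l * e - C ((n:ℝ) * (n + 1)) * (l * e) := by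
        nth_rewrite 1 [he]; ring
      rw [this, map_sub, polyInt_C_mul, polyInt_Leg_symm, hs' _ hLek, hs' _ hek]; ring
    have hL : Leg l = C ((n:ℝ) * (n + 1)) * l := sub_eq_zero.1 he0
    have hq' : q = s + l := by rw [hl]; ring
    have h1 : polyInt (w * (derivative l * derivative s)) = 0 := by
      rw [← polyInt_Leg, hL, mul_assoc, polyInt_C_mul, hs' s hs, mul_zero]
    have h2 : polyInt (w * (derivative l * derivative l)) = n * (n+1) * polyInt (l * l) := by
      rw [← polyInt_Leg, hL, mul_assoc, polyInt_C_mul]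
    have h3 : polyInt (w * (derivative q * derivative q))
        = polyInt (w * (derivative s * derivative s)) + n * (n+1) * polyInt (l * l) := by
      have : w * (derivative q * derivative q) = w * (derivative s * derivative s)
          + C 2 * (w * (derivative l * derivative s)) + w * (derivative l * derivative l) := by
        rw [hq', derivative_add, show (C (2:ℝ)) = 2 from rfl]; ring
      rw [this, map_add, map_add, polyInt_C_mul, h1, h2]; ring
    have h4 : polyInt (q * q) = polyInt (s * s) + polyInt (l * l) := by
      have : q * q = s * s + C 2 * (l * s) + l * l := by
        rw [hq', show (C (2:ℝ)) = 2 from rfl]; ring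
      rw [this, map_add, map_add, polyInt_C_mul, hs' s hs]; ring
    have h5 := ih s hs
    have h6 := polyInt_sq_nonneg q
    have h7 : (0:ℝ) ≤ n := Nat.cast_nonneg n
    rw [h3]
    push_cast
    have : (n:ℝ) * (n+1) * polyInt (q * q) ≤ ((n:ℝ) + 1) * (n + 1 + 1) * polyInt (q * q) := by
      apply mul_le_mul_of_nonneg_right _ h6
      nlinarith
    rw [h4] at this ⊢
    linarith

lemma weight_removal (r : ℝ[X]) (N : ℝ) (hN : 1 ≤ N)
    (h : polyInt (w * (derivative r * derivative r)) ≤ N * polyInt (r * r)) :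
    polyInt (r * r) ≤ 16 * N * polyInt (w * (r * r)) := by
  have hw : derivative w = 1 - C 2 * X := by
    simp only [w, derivative_sub, derivative_X, derivative_X_sq]
  have c2 : (C (2:ℝ)) = 2 := rfl
  have c4 : (C (4:ℝ)) = 4 := rfl
  set z : ℝ[X] := 1 - C 2 * X with hz
  have hdz : derivative z = - C 2 := by simp [hz]
  -- integration by parts
  have h1 := polyInt_deriv (w * (z * (r * r)))
  have h10 : (w * (z * (r * r))).eval 1 - (w * (z * (r * r))).eval 0 = 0 := by
    simp [w]
  have h1' : derivative (w * (z * (r * r))) = r * r - C 4 * (w * (r * r)) - C 2 * (w * (r * r))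
      + C 2 * (w * (z * (r * derivative r))) := by
    simp only [derivative_mul, hw, hdz]
    simp only [hz, w, c2, c4]; ring
  rw [h10, h1', map_add, map_sub, map_sub, polyInt_C_mul, polyInt_C_mul, polyInt_C_mul] at h1
  have h2 := polyInt_w_sq_nonneg (C (2 * N) * r + z * derivative r)
  have h2' : w * ((C (2 * N) * r + z * derivative r) * (C (2 * N) * r + z * derivative r))
      = C (2 * N) * (C (2 * N) * (w * (r * r))) + C 2 * (C (2 * N) * (w * (z * (r * derivative r))))
      + (w * (derivative r * derivative r) - C 4 * ((w * derivative r) * (w * derivative r))) := by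
    simp only [hz, w, c2, c4]; ring
  rw [h2', map_add, map_add, map_sub] at h2
  simp only [polyInt_C_mul] at h2
  have h3 := polyInt_sq_nonneg (w * derivative r)
  have h4 := polyInt_w_sq_nonneg r
  set A := polyInt (r * r)
  set B := polyInt (w * (r * r))
  set T := polyInt (w * (z * (r * derivative r)))
  have h5 : 0 ≤ N * (4 * N * B + 4 * T + A) := by nlinarith
  have h6 : 0 ≤ 4 * N * B + 4 * T + A := nonneg_of_mul_nonneg_right h5 (by linarith)
  nlinarith

/-- L² Markov inequality -/
lemma markov (p : ℕ) (hp : 1 ≤ p) (q : ℝ[X]) (hq : q.natDegree ≤ p) :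
    polyInt (derivative q * derivative q) ≤ 576 * (p:ℝ) ^ 4 * polyInt (q * q) := by
  have hp' : (1:ℝ) ≤ p := by exact_mod_cast hp
  have key : ∀ f : ℝ[X], f.natDegree ≤ p →
      polyInt (w * (derivative f * derivative f)) ≤ 6 * (p:ℝ)^2 * polyInt (f * f) := by
    intro f hf
    have := bernstein (p+1) f (fun k hk => coeff_eq_zero_of_natDegree_lt (by omega))
    refine this.trans (mul_le_mul_of_nonneg_right ?_ (polyInt_sq_nonneg f))
    push_cast; nlinarith
  have hd : (derivative q).natDegree ≤ p := by
    have := natDegree_derivative_le q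
    omega
  have h1 := weight_removal (derivative q) (6 * (p:ℝ)^2) (by nlinarith) (key _ hd)
  have h2 := key q hq
  calc _ ≤ _ := h1
    _ ≤ 16 * (6 * (p:ℝ)^2) * (6 * (p:ℝ)^2 * polyInt (q * q)) := by gcongr
    _ = _ := by ring

/-- the separated extension -/
noncomputable def V (b : ℝ) (f : ℝ[X]) : ℝ × ℝ → ℝ := fun z => f.eval z.1 * Real.exp (b * z.2)

lemma V_contDiff (b : ℝ) (f : ℝ[X]) : ContDiff ℝ 2 (V b f) := by
  unfold V
  exact ((show ContDiff ℝ 2 (fun x : ℝ => f.eval x) by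
    simpa only [Polynomial.coe_aeval_eq_eval] using f.contDiff_aeval (𝕜 := ℝ) 2).comp contDiff_fst).mul
    (Real.contDiff_exp.comp (contDiff_const.mul contDiff_snd))

lemma V_hasFDerivAt (b : ℝ) (f : ℝ[X]) (z : ℝ × ℝ) :
    HasFDerivAt (V b f) (f.eval z.1 • (Real.exp (b * z.2) • (b • ContinuousLinearMap.snd ℝ ℝ ℝ))
      + Real.exp (b * z.2) • ((derivative f).eval z.1 • ContinuousLinearMap.fst ℝ ℝ ℝ)) z := by
  have h1 : HasFDerivAt (fun z : ℝ × ℝ => f.eval z.1) _ z :=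
    (f.hasDerivAt z.1).comp_hasFDerivAt z (hasFDerivAt_fst (𝕜 := ℝ))
  have h2 : HasFDerivAt (fun z : ℝ × ℝ => Real.exp (b * z.2)) _ z :=
    ((hasFDerivAt_snd (𝕜 := ℝ) (p := z)).const_mul b).exp
  exact h1.mul h2

lemma dx_V (b : ℝ) (f : ℝ[X]) : dx (V b f) = V b (derivative f) := by
  funext z
  rw [dx, (V_hasFDerivAt b f z).fderiv]
  simp [V]; ring

lemma dy_V (b : ℝ) (f : ℝ[X]) : dy (V b f) = V b (C b * f) := by
  funext z
  rw [dy, (V_hasFDerivAt b f z).fderiv]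
  simp [V]; ring

lemma V_integrable (b : ℝ) (f : ℝ[X]) : IntegrableOn (fun z => (V b f z) ^ 2) unitSquare := by
  apply ContinuousOn.integrableOn_compact
  · exact isCompact_Icc.prod isCompact_Icc
  · exact ((V_contDiff b f).continuous.pow 2).continuousOn

lemma setInt_eq (f : ℝ[X]) : ∫ x in Set.Icc (0:ℝ) 1, (f.eval x)^2 = polyInt (f * f) := by
  rw [polyInt_apply, intervalIntegral.integral_of_le zero_le_one, integral_Icc_eq_integral_Ioc]
  simp [sq]

lemma V_int_le (ε : ℝ) (hε : 0 < ε) (f : ℝ[X]) :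
    ∫ z in unitSquare, (V (-ε⁻¹) f z) ^ 2 ≤ ε * polyInt (f * f) := by
  have h1 : ∫ z in unitSquare, (V (-ε⁻¹) f z) ^ 2
      = polyInt (f * f) * ∫ y in Set.Icc (0:ℝ) 1, Real.exp (-ε⁻¹ * y) ^ 2 := by
    rw [← setInt_eq, ← setIntegral_prod_mul]
    simp only [V, unitSquare, mul_pow]
    rfl
  have h2 : ∫ y in Set.Icc (0:ℝ) 1, Real.exp (-ε⁻¹ * y) ^ 2 ≤ ε := by
    rw [integral_Icc_eq_integral_Ioc, ← intervalIntegral.integral_of_le zero_le_one]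
    have : ∀ y : ℝ, Real.exp (-ε⁻¹ * y) ^ 2 = Real.exp ((-2 * ε⁻¹) * y) := by
      intro y; rw [sq, ← Real.exp_add]; ring_nf
    simp only [this]
    rw [intervalIntegral.integral_comp_mul_left (fun y => Real.exp y) (by
      have := inv_pos.2 hε; linarith), integral_exp]
    have e1 := Real.exp_pos (-2 * ε⁻¹ * 1)
    simp only [mul_zero, Real.exp_zero, smul_eq_mul]
    have : (-2 * ε⁻¹)⁻¹ = - (ε / 2) := by field_simp
    rw [this]
    nlinarith
  rw [h1, mul_comm ε]
  exact mul_le_mul_of_nonneg_left h2 (polyInt_sq_nonneg f)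

lemma polyInt_scale (b : ℝ) (f : ℝ[X]) :
    polyInt ((C b * f) * (C b * f)) = b ^ 2 * polyInt (f * f) := by
  have : (C b * f) * (C b * f) = C b * (C b * (f * f)) := by ring
  rw [this, polyInt_C_mul, polyInt_C_mul]; ring

end ExtStab

/-- ε-weighted $hp$-explicit polynomial extension stability
result on the unit square (Proposition 3.8 of the paper, squared form,
square case, where the trace of the extension on the bottom edge is `q`). -/
theorem extension_stability_square :
    ∃ c : ℝ, 0 < c ∧
      ∀ ε : ℝ, ε ∈ Set.Ioc (0 : ℝ) 1 → ∀ p : ℕ, 1 ≤ p →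
        ∀ q : Polynomial ℝ, q.natDegree ≤ p →
          ∃ v : ℝ × ℝ → ℝ, ContDiff ℝ 2 v ∧
            (∀ x ∈ Set.Icc (0 : ℝ) 1, v (x, 0) = q.eval x) ∧
            ((∫ z in unitSquare, (v z) ^ 2) ≤
              c * ε * ∫ x in Set.Icc (0 : ℝ) 1, (q.eval x) ^ 2) ∧
            ((∫ z in unitSquare, ((dx v z) ^ 2 + (dy v z) ^ 2)) ≤
              c * (ε * (p : ℝ) ^ 4 + ε⁻¹) *
                ∫ x in Set.Icc (0 : ℝ) 1, (q.eval x) ^ 2) ∧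
            ((∫ z in unitSquare,
                ((dx (dx v) z) ^ 2 + 2 * (dx (dy v) z) ^ 2 + (dy (dy v) z) ^ 2)) ≤
              c * (ε * (p : ℝ) ^ 8 + ε ^ (-3 : ℤ) + ε⁻¹ * (p : ℝ) ^ 4) *
                ∫ x in Set.Icc (0 : ℝ) 1, (q.eval x) ^ 2) := by
  refine ⟨1000000, by norm_num, fun ε hε p hp q hq => ?_⟩
  obtain ⟨hε0, hε1⟩ := hε
  have hi : 0 < ε⁻¹ := inv_pos.2 hε0
  have hd : q.derivative.natDegree ≤ p := by
    have := Polynomial.natDegree_derivative_le q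
    omega
  have m1 := ExtStab.markov p hp q hq
  have m2 := ExtStab.markov p hp _ hd
  have hQ := ExtStab.polyInt_sq_nonneg q
  have hee : ε * ε⁻¹ = 1 := mul_inv_cancel₀ hε0.ne'
  refine ⟨ExtStab.V (-ε⁻¹) q, ExtStab.V_contDiff _ _, ?_, ?_, ?_, ?_⟩
  · intro x _; simp [ExtStab.V]
  · rw [ExtStab.setInt_eq]
    have := ExtStab.V_int_le ε hε0 q
    have h0 : 0 ≤ ε * polyInt (q * q) := by positivity
    linarith
  · rw [ExtStab.setInt_eq, ExtStab.dx_V, ExtStab.dy_V,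
      integral_add (ExtStab.V_integrable _ _) (ExtStab.V_integrable _ _)]
    have a1 := ExtStab.V_int_le ε hε0 q.derivative
    have a2 := ExtStab.V_int_le ε hε0 (Polynomial.C (-ε⁻¹) * q)
    rw [ExtStab.polyInt_scale] at a2
    have b1 := mul_le_mul_of_nonneg_left m1 hε0.le
    have e2 : ε * ((-ε⁻¹)^2 * polyInt (q * q)) = ε⁻¹ * polyInt (q * q) := by
      field_simp
    rw [e2] at a2
    have p1 : 0 ≤ ε * ((p:ℝ)^4 * polyInt (q * q)) := by positivity
    have p2 : 0 ≤ ε⁻¹ * polyInt (q * q) := by positivity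
    linarith
  · rw [ExtStab.setInt_eq, ExtStab.dx_V, ExtStab.dy_V, ExtStab.dx_V, ExtStab.dx_V, ExtStab.dy_V]
    have i12 := fun f g => (ExtStab.V_integrable (-ε⁻¹) f).add
      ((ExtStab.V_integrable (-ε⁻¹) g).const_mul 2)
    simp only [Pi.add_def] at i12
    rw [integral_add (i12 _ _) (ExtStab.V_integrable _ _),
      integral_add (ExtStab.V_integrable _ _) ((ExtStab.V_integrable _ _).const_mul 2),
      integral_const_mul]
    have a1 := ExtStab.V_int_le ε hε0 q.derivative.derivative
    have a2 := ExtStab.V_int_le ε hε0 (Polynomial.C (-ε⁻¹) * q).derivative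
    have a3 := ExtStab.V_int_le ε hε0 (Polynomial.C (-ε⁻¹) * (Polynomial.C (-ε⁻¹) * q))
    rw [Polynomial.derivative_C_mul, ExtStab.polyInt_scale] at a2
    rw [ExtStab.polyInt_scale, ExtStab.polyInt_scale] at a3
    rw [Polynomial.derivative_C_mul]
    have e2 : ε * ((-ε⁻¹)^2 * polyInt (q.derivative * q.derivative))
        = ε⁻¹ * polyInt (q.derivative * q.derivative) := by
      field_simp
    have e3 : ε * ((-ε⁻¹)^2 * ((-ε⁻¹)^2 * polyInt (q * q))) = ε ^ (-3:ℤ) * polyInt (q * q) := by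
      rw [zpow_neg]
      norm_cast
      field_simp
    rw [e2] at a2
    rw [e3] at a3
    have b1 : ε * polyInt (q.derivative.derivative * q.derivative.derivative)
        ≤ ε * (576 * (p:ℝ)^4 * (576 * (p:ℝ)^4 * polyInt (q * q))) := by
      refine mul_le_mul_of_nonneg_left (m2.trans ?_) hε0.le
      exact mul_le_mul_of_nonneg_left m1 (by positivity)
    have b2 := mul_le_mul_of_nonneg_left m1 hi.le
    have p1 : 0 ≤ ε * ((p:ℝ)^8 * polyInt (q * q)) := by positivity
    have p2 : 0 ≤ ε⁻¹ * ((p:ℝ)^4 * polyInt (q * q)) := by positivity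
    have p3 : 0 ≤ ε ^ (-3:ℤ) * polyInt (q * q) := by positivity
    linarith
end

section
/- There exists a constant c > 0 such that for every ε ∈ (0,1], every integer p ≥ 1, and every real polynomial q in one variable of degree at most p, the function v(x,y) = q(x)·x·(1 − x − y)·e^{−y/ε} on T = {(x,y) ∈ ℝ² : x ≥ 0, y ≥ 0, x + y ≤ 1} satisfies, with M = ∫_0^1 q(x)² dx: ∫_T v² ≤ c·ε·M; ∫_T (∂_x v)² ≤ c·ε·p⁴·M; ∫_T (∂_y v)² ≤ c·ε^{−1}·M; ∫_T (∂_{xx} v)² ≤ c·ε·p⁸·M; ∫_T (∂_{yy} v)² ≤ c·ε^{−3}·M; and ∫_T (∂_{xy} v)² ≤ c·ε^{−1}·p⁴·M. -/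
open MeasureTheory

/-- The reference triangle `T = {(x,y) : x ≥ 0, y ≥ 0, x + y ≤ 1}`. -/
def refTriangle : Set (ℝ × ℝ) := {z | 0 ≤ z.1 ∧ 0 ≤ z.2 ∧ z.1 + z.2 ≤ 1}

open Polynomial in
/-- integral over the unit interval as a linear functional on polynomials -/
noncomputable def intI : ℝ[X] →ₗ[ℝ] ℝ where
  toFun P := ∫ x in (0:ℝ)..1, P.eval x
  map_add' P Q := by
    simp only [Polynomial.eval_add]
    exact intervalIntegral.integral_add (P.continuous.intervalIntegrable _ _)
      (Q.continuous.intervalIntegrable _ _)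
  map_smul' a P := by
    simp [Polynomial.eval_smul]

section markov
open Polynomial

theorem intI_def (P : ℝ[X]) : intI P = ∫ x in (0:ℝ)..1, P.eval x := rfl

theorem intI_derivative (P : ℝ[X]) : intI (derivative P) = P.eval 1 - P.eval 0 := by
  rw [intI_def]
  exact intervalIntegral.integral_eq_sub_of_hasDerivAt (fun x _ => P.hasDerivAt x)
    ((derivative P).continuous.intervalIntegrable _ _)

theorem intI_mono (P Q : ℝ[X]) (h : ∀ x ∈ Set.Icc (0:ℝ) 1, P.eval x ≤ Q.eval x) :
    intI P ≤ intI Q :=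
  intervalIntegral.integral_mono_on zero_le_one (P.continuous.intervalIntegrable _ _)
      (Q.continuous.intervalIntegrable _ _) h

theorem intI_sq_nonneg (P : ℝ[X]) : 0 ≤ intI (P * P) := by
  have := intI_mono 0 (P * P) (fun x _ => by simpa using mul_self_nonneg _)
  simpa using this

theorem intI_sq_eq_zero (P : ℝ[X]) (h : intI (P * P) = 0) : P = 0 := by
  by_contra hP
  have hfin : (P.roots.toFinset : Set ℝ).Finite := Finset.finite_toSet _
  have hinf : (Set.Icc (0:ℝ) 1).Infinite := Set.Icc_infinite zero_lt_one
  obtain ⟨x, hx, hxr⟩ := hinf.exists_notMem_finite hfin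
  have hx0 : P.eval x ≠ 0 := by
    intro h0
    apply hxr
    simp [hP, h0]
  have : 0 < ∫ x in (0:ℝ)..1, (P * P).eval x := by
    apply intervalIntegral.integral_pos zero_lt_one (P * P).continuous.continuousOn
    · intro x _
      simpa using mul_self_nonneg _
    · exact ⟨x, hx, by simpa using hx0⟩
  rw [intI_def] at h
  linarith

/-- existence of Legendre-type polynomial -/
theorem exists_orth (n : ℕ) : ∃ L : ℝ[X], L.Monic ∧ L.natDegree = n ∧
    ∀ r : ℝ[X], r.degree < n → intI (L * r) = 0 := by
  let V := degreeLT ℝ n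
  let B : V →ₗ[ℝ] (Module.Dual ℝ V) :=
    LinearMap.mk₂ ℝ (fun a b => intI ((a : ℝ[X]) * b))
      (by intros; simp [add_mul]) (by intros; simp)
      (by intros; simp [mul_add]) (by intros; simp)
  have hfd : FiniteDimensional ℝ V := (degreeLTEquiv ℝ n).symm.finiteDimensional
  have hinj : Function.Injective B := by
    rw [injective_iff_map_eq_zero]
    intro a ha
    have : intI ((a : ℝ[X]) * a) = 0 := by
      have := congrArg (fun f => f a) ha
      simpa [B] using this
    exact Subtype.ext (intI_sq_eq_zero _ this)
  have hsurj : Function.Surjective B :=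
    (LinearMap.injective_iff_surjective_of_finrank_eq_finrank
      (Subspace.dual_finrank_eq).symm).1 hinj
  let φ : Module.Dual ℝ V :=
    { toFun := fun b => intI (X ^ n * (b : ℝ[X]))
      map_add' := by intros; simp [mul_add]
      map_smul' := by intros; simp }
  obtain ⟨s, hs⟩ := hsurj φ
  have hsd : (s : ℝ[X]).degree < n := mem_degreeLT.1 s.2
  refine ⟨X ^ n - (s : ℝ[X]), monic_X_pow_sub hsd, ?_, ?_⟩
  · rw [natDegree_eq_of_degree_eq_some]
    rw [degree_sub_eq_left_of_degree_lt] <;> simp [hsd]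
  · intro r hr
    have := congrArg (fun f => f ⟨r, mem_degreeLT.2 hr⟩) hs
    simp only [B, φ, LinearMap.mk₂_apply, LinearMap.coe_mk, AddHom.coe_mk] at this
    rw [sub_mul, map_sub, this, sub_self]

theorem degree_lt_of (n : ℕ) (P : ℝ[X]) (h1 : P.natDegree ≤ n) (h2 : P.coeff n = 0) :
    P.degree < n := by
  rw [degree_lt_iff_coeff_zero]
  intro m hm
  rcases hm.lt_or_eq with h | h
  · exact coeff_eq_zero_of_natDegree_lt (lt_of_le_of_lt h1 h)
  · exact h ▸ h2

/-- norm of derivative of the orthogonal polynomial -/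
theorem orth_deriv (n : ℕ) (hn : 1 ≤ n) (L : ℝ[X]) (hm : L.Monic) (hd : L.natDegree = n)
    (ho : ∀ r : ℝ[X], r.degree < n → intI (L * r) = 0) :
    intI (derivative L * derivative L) = 2 * n * (n + 1) * (2 * n + 1) * intI (L * L) := by
  obtain ⟨m, rfl⟩ : ∃ m, n = m + 1 := ⟨n - 1, by omega⟩
  have hlc : L.coeff (m + 1) = 1 := by rw [← hd]; exact hm
  have hd' : (derivative L).natDegree ≤ m := by
    have := natDegree_derivative_le L; omega
  have hd'' : (derivative (derivative L)).natDegree ≤ m := by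
    have := natDegree_derivative_le (derivative L); omega
  have lt_of_le : ∀ P : ℝ[X], P.natDegree ≤ m → P.degree < ((m + 1 : ℕ) : WithBot ℕ) := fun P hP =>
    degree_lt_of _ _ (by omega) (coeff_eq_zero_of_natDegree_lt (by omega))
  -- integration by parts
  have e1 : intI (derivative L * derivative L)
      = L.eval 1 * (derivative L).eval 1 - L.eval 0 * (derivative L).eval 0 := by
    have h := intI_derivative (L * derivative L)
    rw [derivative_mul, map_add, ho _ (lt_of_le _ hd''), add_zero] at h
    simpa using h
  -- leading coefficient comparison
  have hxL : intI (L * (X * derivative L)) = (m + 1) * intI (L * L) := by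
    have hlow : (X * derivative L - C ((m:ℝ) + 1) * L).degree < ((m + 1 : ℕ) : WithBot ℕ) := by
      apply degree_lt_of
      · apply (natDegree_sub_le _ _).trans
        apply max_le
        · apply (natDegree_mul_le).trans
          rw [natDegree_X]; omega
        · exact (natDegree_C_mul_le _ _).trans hd.le
      · rw [coeff_sub, coeff_X_mul, coeff_C_mul, coeff_derivative]; ring
    have h := ho _ hlow
    have h2 : L * (X * derivative L - C ((m:ℝ) + 1) * L)
        = L * (X * derivative L) - ((m:ℝ) + 1) • (L * L) := by
      rw [smul_eq_C_mul]; ring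
    rw [h2, map_sub, map_smul, smul_eq_mul] at h
    linarith
  have hLL : intI (L * derivative L) = 0 := ho _ (lt_of_le _ hd')
  have e2 : L.eval 1 * L.eval 1 = (2 * (m + 1) + 1) * intI (L * L) := by
    have h := intI_derivative (X * (L * L))
    have h2 : derivative (X * (L * L))
        = L * L + L * (X * derivative L) + L * (X * derivative L) := by
      rw [derivative_mul, derivative_mul, derivative_X]; ring
    rw [h2, map_add, map_add, hxL] at h
    simp at h
    linarith
  have e3 : L.eval 0 * L.eval 0 = (2 * (m + 1) + 1) * intI (L * L) := by
    have h := intI_derivative ((1 - X) * (L * L))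
    have h2 : derivative ((1 - X) * (L * L))
        = L * derivative L + L * derivative L
          - (L * L + L * (X * derivative L) + L * (X * derivative L)) := by
      rw [derivative_mul, derivative_mul, derivative_sub, derivative_X, derivative_one]; ring
    rw [h2, map_sub, map_add, map_add, map_add, hxL, hLL] at h
    simp at h
    linarith
  -- Legendre ODE
  have ode : derivative ((X * (1 - X)) * derivative L)
      = C (-(((m:ℝ) + 1) * (m + 2))) * L := by
    set W : ℝ[X] := derivative ((X * (1 - X)) * derivative L)
        - C (-(((m:ℝ) + 1) * (m + 2))) * L with hW
    have hWd : W.degree < ((m + 1 : ℕ) : WithBot ℕ) := by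
      have hWe : W = derivative (X * derivative L) - derivative (X * (X * derivative L))
          - C (-(((m:ℝ) + 1) * (m + 2))) * L := by
        rw [hW, ← derivative_sub]; congr 2; ring
      have hdx : (X * derivative L).natDegree ≤ m + 1 := by
        apply (natDegree_mul_le).trans
        rw [natDegree_X]; omega
      have hdxx : (X * (X * derivative L)).natDegree ≤ m + 2 := by
        apply (natDegree_mul_le).trans
        rw [natDegree_X]; omega
      apply degree_lt_of
      · rw [hWe]
        apply (natDegree_sub_le _ _).trans
        apply max_le
        · apply (natDegree_sub_le _ _).trans
          apply max_le
          · have := natDegree_derivative_le (X * derivative L); omega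
          · have := natDegree_derivative_le (X * (X * derivative L)); omega
        · exact (natDegree_C_mul_le _ _).trans hd.le
      · rw [hWe, coeff_sub, coeff_sub, coeff_C_mul, coeff_derivative, coeff_derivative,
          coeff_X_mul, coeff_X_mul, coeff_X_mul, coeff_derivative, coeff_derivative, hlc,
          coeff_eq_zero_of_natDegree_lt (show L.natDegree < m + 1 + 1 by omega)]
        push_cast; ring
    have key : ∀ r : ℝ[X], r.natDegree ≤ m →
        intI (derivative ((X * (1 - X)) * derivative L) * r) = 0 := by
      intro r hr
      have h1 := intI_derivative (((X * (1 - X)) * derivative L) * r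
        - L * ((X * (1 - X)) * derivative r))
      have hdd : (derivative ((X * (1 - X)) * derivative r)).degree < ((m + 1 : ℕ) : WithBot ℕ) := by
        by_cases hm0 : r.natDegree = 0
        · rw [natDegree_eq_zero] at hm0
          obtain ⟨a, rfl⟩ := hm0
          simp
        apply lt_of_le
        have h5 := natDegree_derivative_le ((X * (1 - X)) * derivative r)
        have h6 := natDegree_derivative_le r
        have h7 : ((X * (1 - X)) * derivative r).natDegree
            ≤ (X * (1 - X) : ℝ[X]).natDegree + (derivative r).natDegree := natDegree_mul_le
        have h8 : (X * (1 - X) : ℝ[X]).natDegree ≤ 2 := by compute_degree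
        omega
      have h2 : derivative (((X * (1 - X)) * derivative L) * r
          - L * ((X * (1 - X)) * derivative r))
          = derivative ((X * (1 - X)) * derivative L) * r
            - L * derivative ((X * (1 - X)) * derivative r) := by
        rw [derivative_sub, derivative_mul (g := r), derivative_mul (f := L)]; ring
      rw [h2, map_sub, ho _ hdd] at h1
      simpa using h1
    have hWm : W.natDegree ≤ m := by
      by_cases hW0 : W = 0
      · simp [hW0]
      · have := (natDegree_lt_iff_degree_lt hW0).2 hWd
        omega
    have hz : intI (W * W) = 0 := by
      have h3 : W * W = derivative ((X * (1 - X)) * derivative L) * W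
          - (-(((m:ℝ) + 1) * (m + 2))) • (L * W) := by
        rw [smul_eq_C_mul]
        conv_lhs => rw [hW]
        ring
      rw [h3, map_sub, map_smul, key W hWm, ho W hWd]; simp
    exact sub_eq_zero.1 (intI_sq_eq_zero W hz)
  rw [derivative_mul, derivative_mul] at ode
  have o1 := congrArg (eval 1) ode
  have o0 := congrArg (eval 0) ode
  simp at o1 o0
  rw [e1, o0]
  have o1' : (derivative L).eval 1 = ((m:ℝ) + 1) * (m + 2) * L.eval 1 := by linarith
  rw [o1']
  push_cast
  linear_combination ((m:ℝ) + 1) * (m + 2) * e2 + ((m:ℝ) + 1) * (m + 2) * e3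

theorem markov_aux (n : ℕ) : ∀ q : ℝ[X], q.natDegree ≤ n →
    intI (derivative q * derivative q)
      ≤ ((n:ℝ) * (n + 1) ^ 2 * (n + 2) + 1) * intI (q * q) := by
  induction n with
  | zero =>
    intro q hq
    have : derivative q = 0 := by
      rw [eq_C_of_natDegree_le_zero hq]; simp
    rw [this]
    simpa using intI_sq_nonneg q
  | succ m ih =>
    intro q hq
    obtain ⟨L, hm, hd, ho⟩ := exists_orth (m + 1)
    have hL := orth_deriv (m + 1) (by omega) L hm hd ho
    have hlc : L.coeff (m + 1) = 1 := by rw [← hd]; exact hm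
    set a := q.coeff (m + 1)
    set r := q - C a * L with hr
    have hrd : r.degree < ((m + 1 : ℕ) : WithBot ℕ) := by
      apply degree_lt_of
      · apply (natDegree_sub_le _ _).trans
        exact max_le hq ((natDegree_C_mul_le _ _).trans hd.le)
      · rw [hr, coeff_sub, coeff_C_mul, hlc]; simp [a]
    have hrm : r.natDegree ≤ m := by
      by_cases hr0 : r = 0
      · simp [hr0]
      · have := (natDegree_lt_iff_degree_lt hr0).2 hrd
        omega
    have hq' : q = r + C a * L := by rw [hr]; ring
    have h1 := ih r hrm
    have hqq : intI (q * q) = intI (r * r) + a ^ 2 * intI (L * L) := by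
      have : q * q = r * r + (2 * a) • (L * r) + (a ^ 2) • (L * L) := by
        rw [hq', smul_eq_C_mul, smul_eq_C_mul]; simp only [C_mul, C_pow]
        rw [show (C (2:ℝ) : ℝ[X]) = 2 from rfl]; ring
      rw [this, map_add, map_add, map_smul, map_smul, ho r hrd]; simp
    have hdd : intI (derivative q * derivative q) = intI (derivative r * derivative r)
        + 2 * a * intI (derivative r * derivative L)
        + a ^ 2 * intI (derivative L * derivative L) := by
      have : derivative q * derivative q = derivative r * derivative r
          + (2 * a) • (derivative r * derivative L) + (a ^ 2) • (derivative L * derivative L) := by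
        rw [hq', smul_eq_C_mul, smul_eq_C_mul]; simp only [C_mul, C_pow, derivative_add,
          derivative_C_mul]
        rw [show (C (2:ℝ) : ℝ[X]) = 2 from rfl]; ring
      rw [this, map_add, map_add, map_smul, map_smul]; simp
    set S : ℝ := (m:ℝ) * (m + 1) ^ 2 * (m + 2) + 1 with hS
    set ρ : ℝ := 2 * ((m + 1 : ℕ) : ℝ) * (((m + 1 : ℕ) : ℝ) + 1) * (2 * ((m + 1 : ℕ) : ℝ) + 1)
      with hρ
    have hSpos : 0 < S := by positivity
    have hρpos : 0 < ρ := by positivity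
    have hSum : (((m + 1 : ℕ) : ℝ) * (((m + 1 : ℕ) : ℝ) + 1) ^ 2 * (((m + 1 : ℕ) : ℝ) + 2) + 1)
        = S + ρ := by
      rw [hS, hρ]; push_cast; ring
    have hcs : 0 ≤ ρ ^ 2 * intI (derivative r * derivative r)
        - 2 * (ρ * S * a) * intI (derivative r * derivative L)
        + (S * a) ^ 2 * intI (derivative L * derivative L) := by
      have h := intI_sq_nonneg (C ρ * derivative r - C (S * a) * derivative L)
      have e : (C ρ * derivative r - C (S * a) * derivative L)
          * (C ρ * derivative r - C (S * a) * derivative L)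
          = (ρ ^ 2) • (derivative r * derivative r)
          - (2 * (ρ * S * a)) • (derivative r * derivative L)
          + ((S * a) ^ 2) • (derivative L * derivative L) := by
        simp only [smul_eq_C_mul, C_mul, C_pow]
        rw [show (C (2:ℝ) : ℝ[X]) = 2 from rfl]; ring
      rw [e] at h
      simpa using h
    rw [hSum, hqq, hdd, hL]
    rw [hL] at hcs
    have hRR := intI_sq_nonneg (derivative r)
    have : S * ρ * (intI (derivative r * derivative r)
        + 2 * a * intI (derivative r * derivative L)
        + a ^ 2 * (ρ * intI (L * L)))
        ≤ S * ρ * ((S + ρ) * (intI (r * r) + a ^ 2 * intI (L * L))) := by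
      have h3 := mul_le_mul_of_nonneg_left h1 (show 0 ≤ ρ * (S + ρ) by positivity)
      nlinarith [hcs, h3]
    exact le_of_mul_le_mul_left this (by positivity)

theorem markov (p : ℕ) (hp : 1 ≤ p) (q : ℝ[X]) (hq : q.natDegree ≤ p) :
    intI (derivative q * derivative q) ≤ 13 * (p:ℝ) ^ 4 * intI (q * q) := by
  apply (markov_aux p q hq).trans
  apply mul_le_mul_of_nonneg_right _ (intI_sq_nonneg q)
  have h : (1:ℝ) ≤ p := by exact_mod_cast hp
  have h2 : ((p:ℝ) + 1) ^ 2 ≤ (2 * p) ^ 2 := by gcongr; linarith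
  have h3 : (p:ℝ) + 2 ≤ 3 * p := by linarith
  have h4 : (1:ℝ) ≤ (p:ℝ) ^ 4 := one_le_pow₀ h
  calc (p:ℝ) * (p + 1) ^ 2 * (p + 2) + 1 ≤ (p:ℝ) * (2 * p) ^ 2 * (3 * p) + (p:ℝ) ^ 4 := by gcongr
    _ = _ := by ring

end markov

section twod
open Polynomial

/-- the family of functions closed under partial derivatives -/
noncomputable def famU (ε : ℝ) (B C : ℝ[X]) : ℝ × ℝ → ℝ :=
  fun z => (B.eval z.1 * (1 - z.1 - z.2) + C.eval z.1) * Real.exp (-z.2 / ε)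

theorem famU_hasFDerivAt (ε : ℝ) (B C : ℝ[X]) (z : ℝ × ℝ) :
    HasFDerivAt (famU ε B C)
      ((famU ε (derivative B) (derivative C - B) z) • ContinuousLinearMap.fst ℝ ℝ ℝ
        + (famU ε (-(ε⁻¹) • B) (-B - ε⁻¹ • C) z) • ContinuousLinearMap.snd ℝ ℝ ℝ) z := by
  have hf : HasFDerivAt (fun z : ℝ × ℝ => z.1) (ContinuousLinearMap.fst ℝ ℝ ℝ) z := hasFDerivAt_fst
  have hs : HasFDerivAt (fun z : ℝ × ℝ => z.2) (ContinuousLinearMap.snd ℝ ℝ ℝ) z := hasFDerivAt_snd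
  have hB := (B.hasDerivAt z.1).comp_hasFDerivAt z hf
  have hC := (C.hasDerivAt z.1).comp_hasFDerivAt z hf
  have hE := (hs.neg.mul_const ε⁻¹).exp
  have h := ((hB.mul ((hf.const_sub 1).sub hs)).add hC).mul hE
  refine (h.congr_fderiv ?_).congr_of_eventuallyEq (Filter.Eventually.of_forall fun w => ?_)
  · ext <;> simp [famU, div_eq_mul_inv] <;> ring
  · simp [famU, div_eq_mul_inv]

theorem dx_famU (ε : ℝ) (B C : ℝ[X]) :
    dx (famU ε B C) = famU ε (derivative B) (derivative C - B) := by
  funext z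
  simp [dx, (famU_hasFDerivAt ε B C z).fderiv]

theorem dy_famU (ε : ℝ) (B C : ℝ[X]) :
    dy (famU ε B C) = famU ε (-(ε⁻¹) • B) (-B - ε⁻¹ • C) := by
  funext z
  simp [dy, (famU_hasFDerivAt ε B C z).fderiv]

theorem famU_continuous (ε : ℝ) (B C : ℝ[X]) : Continuous (famU ε B C) := by
  unfold famU
  have hB := B.continuous
  have hC := C.continuous
  fun_prop

theorem refTriangle_subset : refTriangle ⊆ Set.Icc (0:ℝ) 1 ×ˢ Set.Icc (0:ℝ) 1 := by
  rintro ⟨x, y⟩ ⟨h1, h2, h3⟩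
  simp only at h1 h2 h3
  exact ⟨⟨h1, by linarith⟩, ⟨h2, by linarith⟩⟩

theorem refTriangle_meas : MeasurableSet refTriangle := by
  apply IsClosed.measurableSet
  unfold refTriangle
  exact (isClosed_le continuous_const continuous_fst).inter
    ((isClosed_le continuous_const continuous_snd).inter
      (isClosed_le (continuous_fst.add continuous_snd) continuous_const))

theorem exp_int (ε : ℝ) (hε : 0 < ε) :
    ∫ y in Set.Icc (0:ℝ) 1, Real.exp (-y / ε) ≤ ε := by
  rw [integral_Icc_eq_integral_Ioc, ← intervalIntegral.integral_of_le zero_le_one]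
  have h : ∀ y ∈ Set.uIcc (0:ℝ) 1,
      HasDerivAt (fun y => -ε * Real.exp (-y / ε)) (Real.exp (-y / ε)) y := by
    intro y _
    have h1 := ((((hasDerivAt_id y).neg).div_const ε).exp).const_mul (-ε)
    have e : -ε * (Real.exp (-y / ε) * (-1 / ε)) = Real.exp (-y / ε) := by field_simp
    exact h1.congr_deriv e
  rw [intervalIntegral.integral_eq_sub_of_hasDerivAt h
    (Continuous.intervalIntegrable (by fun_prop) _ _)]
  have := Real.exp_pos (-1 / ε)
  simp
  positivity

theorem famU_bound (ε : ℝ) (hε : 0 < ε) (B C : ℝ[X]) :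
    ∫ z in refTriangle, (famU ε B C z) ^ 2 ≤ ε * (2 * intI (B * B) + 2 * intI (C * C)) := by
  set P : ℝ[X] := (2:ℝ) • (B * B) + (2:ℝ) • (C * C) with hP
  have hPI : 2 * intI (B * B) + 2 * intI (C * C) = intI P := by simp [hP]
  have hPc := P.continuous
  have hPe : ∀ x, P.eval x = 2 * (B.eval x) ^ 2 + 2 * (C.eval x) ^ 2 := by
    intro x; simp [hP]; ring
  have hPn : ∀ x, 0 ≤ P.eval x := fun x => by rw [hPe]; positivity
  have hK : IsCompact (Set.Icc (0:ℝ) 1 ×ˢ Set.Icc (0:ℝ) 1) := isCompact_Icc.prod isCompact_Icc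
  have hGc : Continuous (fun z : ℝ × ℝ => P.eval z.1 * Real.exp (-z.2 / ε)) := by fun_prop
  have hG := hGc.continuousOn.integrableOn_compact (μ := volume) hK
  have hF : IntegrableOn (fun z => (famU ε B C z) ^ 2) (Set.Icc (0:ℝ) 1 ×ˢ Set.Icc (0:ℝ) 1) volume :=
    ((famU_continuous ε B C).pow 2).continuousOn.integrableOn_compact (μ := volume) hK
  calc ∫ z in refTriangle, (famU ε B C z) ^ 2
      ≤ ∫ z in refTriangle, P.eval z.1 * Real.exp (-z.2 / ε) := by
        apply setIntegral_mono_on (hF.mono_set refTriangle_subset)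
          (hG.mono_set refTriangle_subset) refTriangle_meas
        rintro ⟨x, y⟩ ⟨h1, h2, h3⟩
        simp only at h1 h2 h3
        simp only [famU]
        rw [mul_pow, hPe]
        have hE := Real.exp_pos (-y / ε)
        have hE1 : Real.exp (-y / ε) ≤ 1 := by
          rw [Real.exp_le_one_iff, neg_div]
          have : 0 ≤ y / ε := by positivity
          linarith
        have ha : (B.eval x * (1 - x - y) + C.eval x) ^ 2
            ≤ 2 * (B.eval x) ^ 2 + 2 * (C.eval x) ^ 2 := by
          have hb : (B.eval x * (1 - x - y)) ^ 2 ≤ (B.eval x) ^ 2 := by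
            rw [mul_pow]
            apply mul_le_of_le_one_right (sq_nonneg _)
            apply pow_le_one₀ <;> linarith
          nlinarith [sq_nonneg (B.eval x * (1 - x - y) - C.eval x)]
        apply mul_le_mul ha _ (sq_nonneg _) (by positivity)
        nlinarith
    _ ≤ ∫ z in Set.Icc (0:ℝ) 1 ×ˢ Set.Icc (0:ℝ) 1, P.eval z.1 * Real.exp (-z.2 / ε) := by
        apply setIntegral_mono_set hG
        · exact Filter.Eventually.of_forall fun z => mul_nonneg (hPn _) (Real.exp_pos _).le
        · exact refTriangle_subset.eventuallyLE
    _ = (∫ x in Set.Icc (0:ℝ) 1, P.eval x) * ∫ y in Set.Icc (0:ℝ) 1, Real.exp (-y / ε) := by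
        rw [Measure.volume_eq_prod]
        exact setIntegral_prod_mul (fun x => P.eval x) (fun y => Real.exp (-y / ε)) _ _
    _ ≤ intI P * ε := by
        rw [integral_Icc_eq_integral_Ioc (f := fun x => P.eval x),
          ← intervalIntegral.integral_of_le zero_le_one, ← intI_def]
        apply mul_le_mul_of_nonneg_left (exp_int ε hε)
        rw [← hPI]
        have := intI_sq_nonneg B
        have := intI_sq_nonneg C
        positivity
    _ = _ := by rw [hPI]; ring

end twod

/-- explicit bounds for the extension
`v(x,y) = q(x)·x·(1-x-y)·e^{-y/ε}` on the reference triangle established in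
the proof of Proposition 3.8 of the paper (triangle case). -/
theorem explicit_extension_bounds_triangle :
    ∃ c : ℝ, 0 < c ∧
      ∀ ε : ℝ, ε ∈ Set.Ioc (0 : ℝ) 1 → ∀ p : ℕ, 1 ≤ p →
        ∀ q : Polynomial ℝ, q.natDegree ≤ p →
          let v : ℝ × ℝ → ℝ :=
            fun z => q.eval z.1 * z.1 * (1 - z.1 - z.2) * Real.exp (-z.2 / ε)
          let M : ℝ := ∫ x in Set.Icc (0 : ℝ) 1, (q.eval x) ^ 2
          ((∫ z in refTriangle, (v z) ^ 2) ≤ c * ε * M) ∧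
          ((∫ z in refTriangle, (dx v z) ^ 2) ≤ c * ε * (p : ℝ) ^ 4 * M) ∧
          ((∫ z in refTriangle, (dy v z) ^ 2) ≤ c * ε⁻¹ * M) ∧
          ((∫ z in refTriangle, (dx (dx v) z) ^ 2) ≤ c * ε * (p : ℝ) ^ 8 * M) ∧
          ((∫ z in refTriangle, (dy (dy v) z) ^ 2) ≤ c * ε ^ (-3 : ℤ) * M) ∧
          ((∫ z in refTriangle, (dx (dy v) z) ^ 2) ≤ c * ε⁻¹ * (p : ℝ) ^ 4 * M) := by
  refine ⟨100000, by norm_num, ?_⟩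
  intro ε hε p hp q hq v M
  obtain ⟨h0, h1⟩ := hε
  set A : Polynomial ℝ := q * Polynomial.X with hA
  have hv : v = famU ε A 0 := by
    funext z; simp [v, famU, hA]
  have hM : M = intI (q * q) := by
    simp only [M]
    rw [integral_Icc_eq_integral_Ioc, ← intervalIntegral.integral_of_le zero_le_one, intI_def]
    simp [sq]
  have hM0 : 0 ≤ M := hM ▸ intI_sq_nonneg q
  have hAM : intI (A * A) ≤ M := by
    rw [hM]
    apply intI_mono
    rintro x ⟨hx0, hx1⟩
    simp only [hA, Polynomial.eval_mul, Polynomial.eval_X]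
    have : x ^ 2 ≤ 1 := pow_le_one₀ hx0 hx1
    nlinarith [sq_nonneg (q.eval x)]
  have hp1 : (1:ℝ) ≤ p := by exact_mod_cast hp
  have hAd : A.natDegree ≤ p + 1 := by
    apply Polynomial.natDegree_mul_le.trans
    rw [Polynomial.natDegree_X]; omega
  clear_value A
  have hdAd : (Polynomial.derivative A).natDegree ≤ p := by
    have := Polynomial.natDegree_derivative_le A; omega
  set dA := Polynomial.derivative A with hdA
  set ddA := Polynomial.derivative dA with hddA
  have hA0 := intI_sq_nonneg A
  have hA1 : intI (dA * dA) ≤ 208 * (p:ℝ) ^ 4 * M := by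
    apply (markov (p + 1) (by omega) A hAd).trans
    push_cast
    have : ((p:ℝ) + 1) ^ 4 ≤ (2 * p) ^ 4 := by gcongr; linarith
    calc 13 * ((p:ℝ) + 1) ^ 4 * intI (A * A) ≤ 13 * (2 * p) ^ 4 * M := by gcongr
      _ = _ := by ring
  have hA2 : intI (ddA * ddA) ≤ 2704 * (p:ℝ) ^ 8 * M := by
    apply (markov p hp dA hdAd).trans
    calc 13 * (p:ℝ) ^ 4 * intI (dA * dA) ≤ 13 * (p:ℝ) ^ 4 * (208 * (p:ℝ) ^ 4 * M) := by gcongr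
      _ = _ := by ring
  have hp4 : 1 ≤ (p:ℝ) ^ 4 := one_le_pow₀ hp1
  have hp48 : (p:ℝ) ^ 4 ≤ (p:ℝ) ^ 8 := pow_le_pow_right₀ hp1 (by norm_num)
  have hM4 : M ≤ (p:ℝ) ^ 4 * M := le_mul_of_one_le_left hM0 hp4
  have hM48 : (p:ℝ) ^ 4 * M ≤ (p:ℝ) ^ 8 * M := mul_le_mul_of_nonneg_right hp48 hM0
  have hi1 : 1 ≤ ε⁻¹ := (one_le_inv₀ h0).2 h1
  have hi0 : 0 < ε⁻¹ := by positivity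
  have hi2 : 1 ≤ ε⁻¹ ^ 2 := one_le_pow₀ hi1
  have hee : ε * ε⁻¹ = 1 := mul_inv_cancel₀ h0.ne'
  have hA1n := intI_sq_nonneg dA
  have smulsq : ∀ (a : ℝ) (P : Polynomial ℝ), intI ((a • P) * (a • P)) = a ^ 2 * intI (P * P) := by
    intro a P
    rw [smul_mul_smul_comm, map_smul, smul_eq_mul]; ring
  have negsq : ∀ (P : Polynomial ℝ), intI ((-P) * (-P)) = intI (P * P) := by
    intro P; rw [neg_mul_neg]
  rw [hv]
  refine ⟨?_, ?_, ?_, ?_, ?_, ?_⟩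
  · apply (famU_bound ε h0 _ _).trans
    rw [mul_zero, map_zero, mul_comm (100000:ℝ) ε, mul_assoc]
    apply mul_le_mul_of_nonneg_left _ h0.le
    linarith
  · rw [dx_famU]
    apply (famU_bound ε h0 _ _).trans
    rw [Polynomial.derivative_zero, zero_sub, negsq, mul_comm (100000:ℝ) ε, mul_assoc, mul_assoc]
    apply mul_le_mul_of_nonneg_left _ h0.le
    linarith
  · rw [dy_famU]
    apply (famU_bound ε h0 _ _).trans
    rw [smul_zero, sub_zero, negsq, smulsq]
    have e : 100000 * ε⁻¹ * M = ε * (ε⁻¹ ^ 2 * (100000 * M)) := by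
      linear_combination (-100000 * ε⁻¹ * M) * hee
    rw [e]
    apply mul_le_mul_of_nonneg_left _ h0.le
    nlinarith
  · rw [dx_famU, dx_famU]
    apply (famU_bound ε h0 _ _).trans
    have e : Polynomial.derivative (Polynomial.derivative 0 - A) - Polynomial.derivative A
        = (-2:ℝ) • dA := by
      rw [Polynomial.derivative_zero, zero_sub, Polynomial.derivative_neg, ← hdA]
      module
    rw [e, smulsq, mul_comm (100000:ℝ) ε, mul_assoc, mul_assoc]
    apply mul_le_mul_of_nonneg_left _ h0.le
    linarith
  · rw [dy_famU, dy_famU]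
    apply (famU_bound ε h0 _ _).trans
    have e1 : -ε⁻¹ • (-ε⁻¹ • A) = (ε⁻¹ ^ 2) • A := by module
    have e2 : -(-ε⁻¹ • A) - ε⁻¹ • (-A - ε⁻¹ • (0 : Polynomial ℝ)) = (2 * ε⁻¹) • A := by module
    rw [e1, e2, smulsq, smulsq]
    have e : 100000 * ε ^ (-3:ℤ) * M = ε * (ε⁻¹ ^ 4 * (100000 * M)) := by
      have : ε ^ (-3:ℤ) = ε⁻¹ ^ 3 := by
        rw [zpow_neg, inv_pow]; norm_cast
      rw [this]
      linear_combination (-100000 * ε⁻¹ ^ 3 * M) * hee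
    rw [e]
    apply mul_le_mul_of_nonneg_left _ h0.le
    have h24 : ε⁻¹ ^ 2 ≤ ε⁻¹ ^ 4 := pow_le_pow_right₀ hi1 (by norm_num)
    have : ε⁻¹ ^ 4 * intI (A * A) ≤ ε⁻¹ ^ 4 * M := by gcongr
    have : ε⁻¹ ^ 2 * intI (A * A) ≤ ε⁻¹ ^ 4 * M := by gcongr
    have : 0 ≤ ε⁻¹ ^ 4 * M := by positivity
    nlinarith
  · rw [dy_famU, dx_famU]
    apply (famU_bound ε h0 _ _).trans
    have e1 : Polynomial.derivative (-ε⁻¹ • A) = (-ε⁻¹) • dA := by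
      rw [Polynomial.derivative_smul]
    have e2 : Polynomial.derivative (-A - ε⁻¹ • (0 : Polynomial ℝ)) - -ε⁻¹ • A
        = ε⁻¹ • A - dA := by
      rw [smul_zero, sub_zero, Polynomial.derivative_neg, ← hdA]; module
    have h3 : intI ((ε⁻¹ • A - dA) * (ε⁻¹ • A - dA))
        ≤ 2 * (ε⁻¹ ^ 2 * intI (A * A)) + 2 * intI (dA * dA) := by
      have h := intI_sq_nonneg (ε⁻¹ • A + dA)
      have e : (ε⁻¹ • A - dA) * (ε⁻¹ • A - dA) = (2:ℝ) • ((ε⁻¹ • A) * (ε⁻¹ • A))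
          + (2:ℝ) • (dA * dA) - (ε⁻¹ • A + dA) * (ε⁻¹ • A + dA) := by
        rw [two_smul, two_smul]; ring
      rw [e, map_sub, map_add, map_smul, map_smul, smulsq]
      simp only [smul_eq_mul]
      linarith
    rw [e1, e2, smulsq]
    have e : 100000 * ε⁻¹ * (p:ℝ) ^ 4 * M = ε * (ε⁻¹ ^ 2 * (100000 * ((p:ℝ) ^ 4 * M))) := by
      linear_combination (-100000 * ε⁻¹ * (p:ℝ) ^ 4 * M) * hee
    rw [e]
    apply mul_le_mul_of_nonneg_left _ h0.le
    have k1 : ε⁻¹ ^ 2 * intI (A * A) ≤ ε⁻¹ ^ 2 * ((p:ℝ) ^ 4 * M) := by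
      gcongr; linarith
    have k2 : ε⁻¹ ^ 2 * intI (dA * dA) ≤ ε⁻¹ ^ 2 * (208 * (p:ℝ) ^ 4 * M) := by gcongr
    have k3 : intI (dA * dA) ≤ ε⁻¹ ^ 2 * intI (dA * dA) := le_mul_of_one_le_left hA1n hi2
    have k4 : 0 ≤ ε⁻¹ ^ 2 * ((p:ℝ) ^ 4 * M) := by positivity
    have k5 : (-ε⁻¹) ^ 2 = ε⁻¹ ^ 2 := by ring
    rw [k5]
    nlinarith
end
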